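/- Let n ≥ 1, k ≥ 1, U > 0, and let Φ ∈ ℝ^{n×(k+1)} have full column rank. Let u ∈ ℝ^{k+1} be the last standard basis vector, e₁ = Φu, e₂ = Φ(ΦᵀΦ)^{−1}u, v = e₁/‖e₁‖₂ + e₂/‖e₂‖₂, and e = √(nU) · v/‖v‖₂. Then: (a) 2 ≤ ‖v‖₂² ≤ 4, i.e., ‖v‖₂² = 2 + 2/(‖e₁‖₂‖e₂‖₂) with 0 < 1/(‖e₁‖₂‖e₂‖₂) ≤ 1; (b) the utility loss of the perturbation is exactly n^{−1} Σ_{i=1}^n e_i² = U; and (c) ⟨e, e₂⟩/‖e₂‖₂ ≥ √(nU/2). -/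

import Mathlib

open Matrix

/-- The Euclidean (`ℓ₂`) norm of a vector in `ℝⁿ`. -/
noncomputable def e2norm {n : ℕ} (v : Fin n → ℝ) : ℝ := Real.sqrt (∑ i, v i ^ 2)

theorem e2norm_sq_aux {n : ℕ} (v : Fin n → ℝ) : e2norm v ^ 2 = v ⬝ᵥ v := by
  unfold e2norm
  rw [Real.sq_sqrt (Finset.sum_nonneg fun i _ => sq_nonneg _)]
  simp [dotProduct, sq]

theorem od_aux (n : ℕ) (hn : 1 ≤ n) (U : ℝ) (hU : 0 < U) (e₁ e₂ : Fin n → ℝ)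
    (h : e₁ ⬝ᵥ e₂ = 1) :
    let v : Fin n → ℝ := (e2norm e₁)⁻¹ • e₁ + (e2norm e₂)⁻¹ • e₂
    let e : Fin n → ℝ := (Real.sqrt (n * U) / e2norm v) • v
    (e2norm v ^ 2 = 2 + 2 / (e2norm e₁ * e2norm e₂) ∧
      0 < 1 / (e2norm e₁ * e2norm e₂) ∧ 1 / (e2norm e₁ * e2norm e₂) ≤ 1 ∧
      2 ≤ e2norm v ^ 2 ∧ e2norm v ^ 2 ≤ 4) ∧
    (1 / (n : ℝ)) * ∑ i : Fin n, e i ^ 2 = U ∧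
    Real.sqrt (n * U / 2) ≤ (e ⬝ᵥ e₂) / e2norm e₂ := by
  intro v e
  have h' : e₂ ⬝ᵥ e₁ = 1 := by rw [dotProduct_comm, h]
  have h1 := e2norm_sq_aux e₁
  have h2 := e2norm_sq_aux e₂
  have hv := e2norm_sq_aux v
  have p1 : 0 ≤ e2norm e₁ := Real.sqrt_nonneg _
  have p2 : 0 ≤ e2norm e₂ := Real.sqrt_nonneg _
  have pv : 0 ≤ e2norm v := Real.sqrt_nonneg _
  have hcs : (1 : ℝ) ≤ (e2norm e₁ * e2norm e₂) ^ 2 := by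
    have := Finset.sum_mul_sq_le_sq_mul_sq Finset.univ e₁ e₂
    change (e₁ ⬝ᵥ e₂) ^ 2 ≤ _ at this
    rw [h] at this
    rw [mul_pow, h1, h2]
    simpa [dotProduct, sq] using this
  have hab : 1 ≤ e2norm e₁ * e2norm e₂ := by
    have := mul_nonneg p1 p2
    nlinarith
  have q1 : 0 < e2norm e₁ := lt_of_le_of_ne p1 (by intro h0; rw [← h0] at hab; norm_num at hab)
  have q2 : 0 < e2norm e₂ := lt_of_le_of_ne p2 (by intro h0; rw [← h0] at hab; norm_num at hab)
  have hve : v ⬝ᵥ e₂ = (e2norm e₁)⁻¹ + e2norm e₂ := by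
    simp only [v, add_dotProduct, smul_dotProduct, h, ← h2, smul_eq_mul]
    field_simp
  have hN : e2norm v ^ 2 = 2 + 2 / (e2norm e₁ * e2norm e₂) := by
    rw [hv]
    simp only [v, add_dotProduct, dotProduct_add, smul_dotProduct, dotProduct_smul, h, h', ← h1,
      ← h2, smul_eq_mul]
    field_simp
    ring
  have r0 : 0 < 1 / (e2norm e₁ * e2norm e₂) := by positivity
  have r1 : 1 / (e2norm e₁ * e2norm e₂) ≤ 1 := by
    rw [div_le_one (by positivity)]; exact hab
  have r2 : 2 / (e2norm e₁ * e2norm e₂) = 2 * (1 / (e2norm e₁ * e2norm e₂)) := by ring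
  have hlo : 2 ≤ e2norm v ^ 2 := by rw [hN, r2]; linarith
  have qv : 0 < e2norm v := lt_of_le_of_ne pv (by intro h0; rw [← h0] at hlo; norm_num at hlo)
  have hn' : (0 : ℝ) < n := by exact_mod_cast hn
  have hs : Real.sqrt (n * U) ^ 2 = n * U := Real.sq_sqrt (by positivity)
  refine ⟨⟨hN, r0, r1, hlo, by rw [hN, r2]; linarith⟩, ?_, ?_⟩
  · have : ∑ i : Fin n, e i ^ 2 = e ⬝ᵥ e := by simp [dotProduct, sq]
    rw [this]
    simp only [e, smul_dotProduct, dotProduct_smul, ← hv, smul_eq_mul]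
    field_simp
    rw [hs]
  · have hc : (e ⬝ᵥ e₂) / e2norm e₂ = Real.sqrt (n * U) * e2norm v / 2 := by
      have : e ⬝ᵥ e₂ / e2norm e₂ = Real.sqrt (n * U) / e2norm v * (e2norm v ^ 2 / 2) := by
        rw [hN]
        simp only [e, smul_dotProduct, hve, smul_eq_mul]
        field_simp
        ring
      rw [this]
      field_simp
    rw [hc]
    apply Real.sqrt_le_iff.mpr
    refine ⟨by positivity, ?_⟩
    rw [div_pow, mul_pow, hs]
    have : 0 < n * U := by positivity
    nlinarith

/-- Properties of the Order Disguise perturbation vector: with `u` the last standard basis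
vector, `e₁ = Φu`, `e₂ = Φ(ΦᵀΦ)⁻¹u`, `v = e₁/‖e₁‖₂ + e₂/‖e₂‖₂`, and `e = √(nU)·v/‖v‖₂`:
(a) `‖v‖₂² = 2 + 2/(‖e₁‖₂‖e₂‖₂)` with `0 < 1/(‖e₁‖₂‖e₂‖₂) ≤ 1`, so `2 ≤ ‖v‖₂² ≤ 4`;
(b) the utility loss is exactly `n⁻¹ Σᵢ eᵢ² = U`;
(c) `⟨e, e₂⟩/‖e₂‖₂ ≥ √(nU/2)`. -/
theorem stmt15 (n k : ℕ) (hn : 1 ≤ n) (hk : 1 ≤ k) (U : ℝ) (hU : 0 < U)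
    (Φ : Matrix (Fin n) (Fin (k + 1)) ℝ) (hΦ : IsUnit (Φᵀ * Φ)) :
    let u : Fin (k + 1) → ℝ := Pi.single (Fin.last k) 1
    let e₁ : Fin n → ℝ := Φ.mulVec u
    let e₂ : Fin n → ℝ := Φ.mulVec ((Φᵀ * Φ)⁻¹.mulVec u)
    let v : Fin n → ℝ := (e2norm e₁)⁻¹ • e₁ + (e2norm e₂)⁻¹ • e₂
    let e : Fin n → ℝ := (Real.sqrt (n * U) / e2norm v) • v
    (e2norm v ^ 2 = 2 + 2 / (e2norm e₁ * e2norm e₂) ∧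
      0 < 1 / (e2norm e₁ * e2norm e₂) ∧ 1 / (e2norm e₁ * e2norm e₂) ≤ 1 ∧
      2 ≤ e2norm v ^ 2 ∧ e2norm v ^ 2 ≤ 4) ∧
    (1 / (n : ℝ)) * ∑ i : Fin n, e i ^ 2 = U ∧
    Real.sqrt (n * U / 2) ≤ (e ⬝ᵥ e₂) / e2norm e₂ := by
  intro u e₁ e₂
  apply od_aux n hn U hU e₁ e₂
  have hd : IsUnit (Φᵀ * Φ).det := (Matrix.isUnit_iff_isUnit_det _).mp hΦ
  have : e₁ ⬝ᵥ e₂ = u ⬝ᵥ ((Φᵀ * Φ) *ᵥ ((Φᵀ * Φ)⁻¹ *ᵥ u)) := by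
    simp only [e₁, e₂]
    rw [← Matrix.mulVec_mulVec _ Φᵀ Φ, Matrix.dotProduct_mulVec u, Matrix.vecMul_transpose]
  rw [this, Matrix.mulVec_mulVec, Matrix.mul_nonsing_inv _ hd, Matrix.one_mulVec]
  simp [u]
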